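/- arXiv:0809.2034 — 2 statements merged into one kernel-verified Lean document; each statement's English description precedes it below -/
import Mathlib

section
/- The group presented by ⟨a, b, c, d, e, f | ba = ae = eb, de = ec = cd, bc = cf = fb, df = fa = ad, ca = ac, ef = fe⟩ is isomorphic to the braid group B₄ = ⟨a, b, c | aba = bab, bcb = cbc, ac = ca⟩, via the homomorphism sending a ↦ a, b ↦ b, c ↦ c, d ↦ (ac)⁻¹b(ac), e ↦ a⁻¹ba, f ↦ c⁻¹bc. -/
/-- Relators for the braid group `B₄ = ⟨a, b, c | aba = bab, bcb = cbc, ac = ca⟩`,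
with generators indexed `0 ↦ a`, `1 ↦ b`, `2 ↦ c`. -/
def braidRels : Set (FreeGroup (Fin 3)) :=
  { FreeGroup.of 0 * FreeGroup.of 1 * FreeGroup.of 0 *
      (FreeGroup.of 1 * FreeGroup.of 0 * FreeGroup.of 1)⁻¹,
    FreeGroup.of 1 * FreeGroup.of 2 * FreeGroup.of 1 *
      (FreeGroup.of 2 * FreeGroup.of 1 * FreeGroup.of 2)⁻¹,
    FreeGroup.of 0 * FreeGroup.of 2 * (FreeGroup.of 2 * FreeGroup.of 0)⁻¹ }

/-- The braid group on four strands. -/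
abbrev B4 := PresentedGroup braidRels

namespace B4

def a : B4 := PresentedGroup.of 0
def b : B4 := PresentedGroup.of 1
def c : B4 := PresentedGroup.of 2

end B4

namespace SixGen

/-- Free generators indexed `0 ↦ a`, `1 ↦ b`, `2 ↦ c`, `3 ↦ d`, `4 ↦ e`, `5 ↦ f`. -/
def ga : FreeGroup (Fin 6) := FreeGroup.of 0
def gb : FreeGroup (Fin 6) := FreeGroup.of 1
def gc : FreeGroup (Fin 6) := FreeGroup.of 2
def gd : FreeGroup (Fin 6) := FreeGroup.of 3
def ge : FreeGroup (Fin 6) := FreeGroup.of 4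
def gf : FreeGroup (Fin 6) := FreeGroup.of 5

/-- Relators expressing `ba = ae = eb`, `de = ec = cd`, `bc = cf = fb`,
`df = fa = ad`, `ca = ac`, `ef = fe`. -/
def rels : Set (FreeGroup (Fin 6)) :=
  { gb * ga * (ga * ge)⁻¹, ga * ge * (ge * gb)⁻¹,
    gd * ge * (ge * gc)⁻¹, ge * gc * (gc * gd)⁻¹,
    gb * gc * (gc * gf)⁻¹, gc * gf * (gf * gb)⁻¹,
    gd * gf * (gf * ga)⁻¹, gf * ga * (ga * gd)⁻¹,
    gc * ga * (ga * gc)⁻¹, ge * gf * (gf * ge)⁻¹ }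

/-- The group presented by
`⟨a, b, c, d, e, f | ba = ae = eb, de = ec = cd, bc = cf = fb, df = fa = ad, ca = ac, ef = fe⟩`. -/
abbrev G := PresentedGroup rels

end SixGen

open B4

section Conjugates

variable {H : Type*} [Group H] {x y z : H}

/-- If `x` and `y` satisfy the braid relation, conjugating `y` by `x` agrees with conjugating
`x` by `y⁻¹`. -/
theorem conj_eq_of_braid (h : x * y * x = y * x * y) : x⁻¹ * y * x = y * x * y⁻¹ := by
  rw [eq_mul_inv_iff_mul_eq, mul_assoc, mul_assoc, inv_mul_eq_iff_eq_mul, ← mul_assoc, ← h,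
    mul_assoc]

/-- If `x` and `y` satisfy the braid relation, then `(x⁻¹ y x) y = y x`. -/
theorem conj_mul_of_braid (h : x * y * x = y * x * y) : x⁻¹ * y * x * y = y * x := by
  rw [conj_eq_of_braid h, inv_mul_cancel_right]

/-- Conjugating the second entry of a braid relation by an element commuting with the first. -/
theorem braid_conj_right (h : x * y * x = y * x * y) (hz : z * x = x * z) :
    x * (z⁻¹ * y * z) * x = z⁻¹ * y * z * x * (z⁻¹ * y * z) := by
  have hx : z⁻¹ * x * z = x := by rw [mul_assoc, ← hz, inv_mul_cancel_left]
  calc x * (z⁻¹ * y * z) * x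
      = z⁻¹ * x * z * (z⁻¹ * y * z) * (z⁻¹ * x * z) := by rw [hx]
    _ = z⁻¹ * (x * y * x) * z := by group
    _ = z⁻¹ * y * z * (z⁻¹ * x * z) * (z⁻¹ * y * z) := by rw [h]; group
    _ = z⁻¹ * y * z * x * (z⁻¹ * y * z) := by rw [hx]

/-- From `y x = x w = w y` one recovers the braid relation between `x` and `y`. -/
theorem braid_of_dual_rels {w : H} (h₁ : y * x = x * w) (h₂ : x * w = w * y) :
    x * y * x = y * x * y := by
  calc x * y * x = x * w * y := by rw [mul_assoc, h₁.trans h₂, mul_assoc]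
    _ = y * x * y := by rw [h₁]

end Conjugates

namespace B4

theorem a_braid_b : a * b * a = b * a * b :=
  PresentedGroup.mk_eq_mk_of_mul_inv_mem (by simp [braidRels])

theorem b_braid_c : b * c * b = c * b * c :=
  PresentedGroup.mk_eq_mk_of_mul_inv_mem (by simp [braidRels])

theorem a_comm_c : a * c = c * a :=
  PresentedGroup.mk_eq_mk_of_mul_inv_mem (by simp [braidRels])

end B4

namespace SixGen

/-- The images in `B4` of the six generators. -/
def genImage : Fin 6 → B4 :=
  ![a, b, c, (a * c)⁻¹ * b * (a * c), a⁻¹ * b * a, c⁻¹ * b * c]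

theorem lift_genImage_eq_one : ∀ r ∈ rels, FreeGroup.lift genImage r = 1 := by
  have hab := a_braid_b
  have hcb := b_braid_c.symm
  have hac := a_comm_c
  have hd_e : (a * c)⁻¹ * b * (a * c) = c⁻¹ * (a⁻¹ * b * a) * c := by group
  have hd_f : (a * c)⁻¹ * b * (a * c) = a⁻¹ * (c⁻¹ * b * c) * a := by rw [hac]; group
  have hce := braid_conj_right hcb hac
  have haf := braid_conj_right hab hac.symm
  have hef : a⁻¹ * b * a * (c⁻¹ * b * c) = c⁻¹ * b * c * (a⁻¹ * b * a) := by
    rw [conj_eq_of_braid hab, conj_eq_of_braid hcb]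
    calc b * a * b⁻¹ * (b * c * b⁻¹) = b * (a * c) * b⁻¹ := by group
      _ = b * c * b⁻¹ * (b * a * b⁻¹) := by rw [hac]; group
  rintro r (rfl | rfl | rfl | rfl | rfl | rfl | rfl | rfl | rfl | rfl) <;>
    simp only [ga, gb, gc, gd, ge, gf, map_mul, map_inv, FreeGroup.lift_apply_of,
      mul_inv_eq_one] <;>
    simp only [genImage, Matrix.cons_val]
  · group
  · rw [conj_mul_of_braid hab]; group
  · rw [hd_e, conj_mul_of_braid hce]
  · rw [hd_e]; group
  · group
  · rw [conj_mul_of_braid hcb]; group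
  · rw [hd_f, conj_mul_of_braid haf]
  · rw [hd_f]; group
  · exact hac.symm
  · exact hef

/-- The homomorphism from the six-generator group to the braid group. -/
def toB4 : G →* B4 := PresentedGroup.toGroup lift_genImage_eq_one

theorem toB4_of (i : Fin 6) : toB4 (PresentedGroup.of i) = genImage i :=
  PresentedGroup.toGroup.of _

/-- The images in the six-generator group of `a`, `b`, `c`. -/
def braidImage : Fin 3 → G :=
  ![PresentedGroup.of 0, PresentedGroup.of 1, PresentedGroup.of 2]

theorem b_mul_a : (.of 1 * .of 0 : G) = .of 0 * .of 4 :=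
  PresentedGroup.mk_eq_mk_of_mul_inv_mem (by simp [rels, ga, gb, ge])

theorem a_mul_e : (.of 0 * .of 4 : G) = .of 4 * .of 1 :=
  PresentedGroup.mk_eq_mk_of_mul_inv_mem (by simp [rels, ga, gb, ge])

theorem e_mul_c : (.of 4 * .of 2 : G) = .of 2 * .of 3 :=
  PresentedGroup.mk_eq_mk_of_mul_inv_mem (by simp [rels, gc, gd, ge])

theorem b_mul_c : (.of 1 * .of 2 : G) = .of 2 * .of 5 :=
  PresentedGroup.mk_eq_mk_of_mul_inv_mem (by simp [rels, gb, gc, gf])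

theorem c_mul_f : (.of 2 * .of 5 : G) = .of 5 * .of 1 :=
  PresentedGroup.mk_eq_mk_of_mul_inv_mem (by simp [rels, gb, gc, gf])

theorem c_mul_a : (.of 2 * .of 0 : G) = .of 0 * .of 2 :=
  PresentedGroup.mk_eq_mk_of_mul_inv_mem (by simp [rels, ga, gc])

theorem lift_braidImage_eq_one : ∀ r ∈ braidRels, FreeGroup.lift braidImage r = 1 := by
  rintro r (rfl | rfl | rfl) <;>
    simp only [map_mul, map_inv, FreeGroup.lift_apply_of, mul_inv_eq_one] <;>
    simp only [braidImage, Matrix.cons_val]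
  · exact braid_of_dual_rels b_mul_a a_mul_e
  · exact (braid_of_dual_rels b_mul_c c_mul_f).symm
  · exact c_mul_a.symm

/-- The homomorphism from the braid group to the six-generator group. -/
def ofB4 : B4 →* G := PresentedGroup.toGroup lift_braidImage_eq_one

theorem ofB4_of (i : Fin 3) : ofB4 (PresentedGroup.of i) = braidImage i :=
  PresentedGroup.toGroup.of _

theorem ofB4_comp_toB4 : ofB4.comp toB4 = MonoidHom.id G := by
  have he : (PresentedGroup.of 0 : G)⁻¹ * .of 1 * .of 0 = .of 4 := by
    rw [mul_assoc, b_mul_a, inv_mul_cancel_left]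
  have hf : (PresentedGroup.of 2 : G)⁻¹ * .of 1 * .of 2 = .of 5 := by
    rw [mul_assoc, b_mul_c, inv_mul_cancel_left]
  have hd : (PresentedGroup.of 0 * PresentedGroup.of 2 : G)⁻¹ * .of 1 * (.of 0 * .of 2) =
      .of 3 := by
    calc (PresentedGroup.of 0 * PresentedGroup.of 2 : G)⁻¹ * .of 1 * (.of 0 * .of 2)
        = (.of 2)⁻¹ * ((.of 0)⁻¹ * .of 1 * .of 0 * .of 2) := by group
      _ = .of 3 := by rw [he, e_mul_c, inv_mul_cancel_left]
  refine PresentedGroup.ext fun i => ?_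
  rw [MonoidHom.comp_apply, toB4_of, MonoidHom.id_apply]
  fin_cases i <;>
    simp [genImage, a, b, c, ofB4_of, braidImage, -mul_inv_rev, he, hf, hd]

theorem toB4_comp_ofB4 : toB4.comp ofB4 = MonoidHom.id B4 := by
  refine PresentedGroup.ext fun i => ?_
  rw [MonoidHom.comp_apply, ofB4_of, MonoidHom.id_apply]
  fin_cases i <;> simp [braidImage, toB4_of, genImage, a, b, c]

end SixGen

theorem statement1 :
    ∃ φ : SixGen.G ≃* B4,
      φ (PresentedGroup.of 0) = a ∧
      φ (PresentedGroup.of 1) = b ∧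
      φ (PresentedGroup.of 2) = c ∧
      φ (PresentedGroup.of 3) = (a * c)⁻¹ * b * (a * c) ∧
      φ (PresentedGroup.of 4) = a⁻¹ * b * a ∧
      φ (PresentedGroup.of 5) = c⁻¹ * b * c := by
  exact ⟨MonoidHom.toMulEquiv SixGen.toB4 SixGen.ofB4 SixGen.ofB4_comp_toB4 SixGen.toB4_comp_ofB4,
    SixGen.toB4_of 0, SixGen.toB4_of 1, SixGen.toB4_of 2, SixGen.toB4_of 3, SixGen.toB4_of 4,
    SixGen.toB4_of 5⟩
end

section
/- Let W₃ = ⟨r, s, t | r² = s² = t² = 1⟩ and let E be the kernel of the homomorphism W₃ → ℤ/2ℤ sending each of r, s, t to 1, so that E is characteristic in W₃ and the restriction homomorphism π : Aut(W₃) → Aut(E) is defined. Then π is surjective: its image contains a generating set of Aut(E), hence every automorphism of E is the restriction of an automorphism of W₃. -/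
/-- Relators for the universal Coxeter group `W₃ = ⟨r, s, t | r² = s² = t² = 1⟩`,
with generators indexed `0 ↦ r`, `1 ↦ s`, `2 ↦ t`. -/
def cox3Rels : Set (FreeGroup (Fin 3)) := { w | ∃ i : Fin 3, w = FreeGroup.of i ^ 2 }

/-- The universal Coxeter group of rank 3. -/
abbrev W3 := PresentedGroup cox3Rels

namespace W3

def r : W3 := PresentedGroup.of 0
def s : W3 := PresentedGroup.of 1
def t : W3 := PresentedGroup.of 2

/-- The parity homomorphism `W₃ → ℤ/2ℤ` sending each of `r`, `s`, `t` to `1`. -/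
def parity : W3 →* Multiplicative (ZMod 2) :=
  PresentedGroup.toGroup (f := fun _ => Multiplicative.ofAdd 1)
    (by rintro w ⟨i, rfl⟩; simp [map_pow]; decide)

/-- The subgroup of even-length elements of `W₃`. -/
def E : Subgroup W3 := parity.ker

end W3

namespace W3

theorem of_mul_self (i : Fin 3) : (PresentedGroup.of i : W3) * PresentedGroup.of i = 1 := by
  have h : PresentedGroup.mk cox3Rels (FreeGroup.of i ^ 2) = 1 :=
    PresentedGroup.one_of_mem ⟨i, rfl⟩
  rwa [map_pow, pow_two] at h

theorem r_mul_r : r * r = 1 := of_mul_self 0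
theorem s_mul_s : s * s = 1 := of_mul_self 1
theorem t_mul_t : t * t = 1 := of_mul_self 2

/-- A homomorphism out of `W₃` from three elements of order dividing two. -/
def lift {G : Type*} [Group G] (f : Fin 3 → G) (hf : ∀ i, f i * f i = 1) : W3 →* G :=
  PresentedGroup.toGroup (f := f) (by rintro w ⟨i, rfl⟩; simp [pow_two, hf])

@[simp]
theorem lift_of {G : Type*} [Group G] (f : Fin 3 → G) (hf : ∀ i, f i * f i = 1) (i : Fin 3) :
    lift f hf (PresentedGroup.of i) = f i :=
  PresentedGroup.toGroup.of _

/-! ### The reflection representation in `GL₂(ℤ)` -/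

/-- Reflections in the sides of the ideal triangle with vertices `0`, `1`, `∞`. -/
def reflMatrix : Fin 3 → Matrix (Fin 2) (Fin 2) ℤ :=
  ![!![1, 0; 2, -1], !![1, 0; 0, -1], !![1, -2; 0, -1]]

theorem reflMatrix_mul_self (i : Fin 3) : reflMatrix i * reflMatrix i = 1 := by
  fin_cases i <;> decide

/-- The reflection representation `W₃ → GL₂(ℤ)`. -/
def rep : W3 →* (Matrix (Fin 2) (Fin 2) ℤ)ˣ :=
  lift (fun i => ⟨reflMatrix i, reflMatrix i, reflMatrix_mul_self i, reflMatrix_mul_self i⟩)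
    fun i => Units.ext (reflMatrix_mul_self i)

/-- The matrix of an element of `W₃` in the reflection representation. -/
def mat (g : W3) : Matrix (Fin 2) (Fin 2) ℤ := rep g

theorem mat_one : mat 1 = 1 := by simp [mat]

theorem mat_mul (g h : W3) : mat (g * h) = mat g * mat h := by simp [mat]

theorem mat_of (i : Fin 3) : mat (PresentedGroup.of i) = reflMatrix i := by simp [mat, rep]

theorem mat_r : mat r = !![1, 0; 2, -1] := mat_of 0
theorem mat_s : mat s = !![1, 0; 0, -1] := mat_of 1
theorem mat_t : mat t = !![1, -2; 0, -1] := mat_of 2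

/-- The quadratic form, in the first column of a matrix, that is negated by the `i`-th reflection
and is positive on the far side of the corresponding mirror. -/
def sideForm (i : Fin 3) (A : Matrix (Fin 2) (Fin 2) ℤ) : ℤ :=
  ![A 0 0 * (A 1 0 - A 0 0), -(A 0 0 * A 1 0), A 1 0 * (A 0 0 - A 1 0)] i

theorem sideForm_reflMatrix_mul (i : Fin 3) (A : Matrix (Fin 2) (Fin 2) ℤ) :
    sideForm i (reflMatrix i * A) = -sideForm i A := by
  fin_cases i <;>
    simp [sideForm, reflMatrix, Matrix.mul_apply, Fin.sum_univ_two, -mul_eq_mul_left_iff] <;> ring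

theorem sideForm_neg_of_pos {i j : Fin 3} (hij : i ≠ j) {A : Matrix (Fin 2) (Fin 2) ℤ}
    (h : 0 < sideForm j A) : sideForm i A < 0 := by
  fin_cases i <;> fin_cases j <;> simp [sideForm] at hij h ⊢ <;>
    nlinarith [sq_nonneg (A 0 0), sq_nonneg (A 1 0), sq_nonneg (A 0 0 - A 1 0)]

theorem exists_sideForm_pos (i : Fin 3) : ∃ A, 0 < sideForm i A := by
  fin_cases i
  exacts [⟨!![1, 0; 2, 0], by decide⟩, ⟨!![1, 0; -1, 0], by decide⟩, ⟨!![2, 0; 1, 0], by decide⟩]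

theorem eq_of_mem_zpowers_of_ne_one {i : Fin 3} {h : W3}
    (hh : h ∈ Subgroup.zpowers (PresentedGroup.of i : W3)) (h1 : h ≠ 1) :
    h = PresentedGroup.of i := by
  obtain ⟨n, rfl⟩ := hh
  have h2 : (PresentedGroup.of i : W3) ^ (2 : ℤ) = 1 := by
    rw [zpow_two, of_mul_self]
  obtain ⟨k, rfl | rfl⟩ := Int.even_or_odd' n
  · simp [zpow_mul, h2] at h1
  · simp [zpow_add, zpow_mul, h2]

open Monoid in
theorem rep_injective : Function.Injective rep := by
  let H : Fin 3 → Type := fun i => Subgroup.zpowers (PresentedGroup.of i : W3)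
  let f : ∀ i, H i →* (Matrix (Fin 2) (Fin 2) ℤ)ˣ := fun i => rep.comp (Subgroup.subtype _)
  have hinj : Function.Injective (CoprodI.lift f) := by
    refine CoprodI.lift_injective_of_ping_pong f (Or.inl (by simp))
      (fun i => {A : Matrix (Fin 2) (Fin 2) ℤ | 0 < sideForm i A}) exists_sideForm_pos ?_ ?_
    · intro i j hij
      refine Set.disjoint_left.2 fun A hi hj => ?_
      exact absurd (sideForm_neg_of_pos hij hj) (not_lt.2 (le_of_lt hi))
    · rintro i j hij ⟨h, hh⟩ h1 _ ⟨A, hA, rfl⟩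
      obtain rfl := eq_of_mem_zpowers_of_ne_one hh fun h0 => h1 (Subtype.ext h0)
      change 0 < sideForm i (mat (PresentedGroup.of i) * A)
      rw [mat_of, sideForm_reflMatrix_mul]
      exact neg_pos.2 (sideForm_neg_of_pos hij hA)
  let e : W3 →* CoprodI H :=
    lift (fun i => CoprodI.of (i := i) ⟨PresentedGroup.of i, Subgroup.mem_zpowers _⟩) fun i => by
      rw [← map_mul, ← map_one (CoprodI.of (M := H) (i := i))]
      exact congrArg _ (Subtype.ext (of_mul_self i))
  let p : CoprodI H →* W3 := CoprodI.lift fun i => Subgroup.subtype _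
  have hpe : p.comp e = MonoidHom.id W3 := PresentedGroup.ext fun i => by
    simp only [p, e, MonoidHom.comp_apply, lift_of, CoprodI.lift_of]
    rfl
  have hrep : rep = (CoprodI.lift f).comp e := PresentedGroup.ext fun i => by
    simp only [f, e, MonoidHom.comp_apply, lift_of, CoprodI.lift_of]
    rfl
  have he : Function.Injective e :=
    Function.LeftInverse.injective (g := p) fun g => DFunLike.congr_fun hpe g
  rw [hrep]
  exact hinj.comp he

theorem mat_injective : Function.Injective mat := fun _ _ h => rep_injective (Units.ext h)

/-! ### The image of the reflection representation -/

/-- The integral matrices with even off-diagonal entries, upper left entry congruent to `1`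
modulo `4` and determinant `±1`. -/
def IsLevelTwo (A : Matrix (Fin 2) (Fin 2) ℤ) : Prop :=
  4 ∣ A 0 0 - 1 ∧ 2 ∣ A 0 1 ∧ 2 ∣ A 1 0 ∧ (A.det = 1 ∨ A.det = -1)

theorem IsLevelTwo.mul {A B : Matrix (Fin 2) (Fin 2) ℤ} (hA : IsLevelTwo A)
    (hB : IsLevelTwo B) : IsLevelTwo (A * B) := by
  obtain ⟨⟨a, ha⟩, ⟨b, hb⟩, ⟨c, hc⟩, hd⟩ := hA
  obtain ⟨⟨a', ha'⟩, ⟨b', hb'⟩, ⟨c', hc'⟩, hd'⟩ := hB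
  rw [sub_eq_iff_eq_add] at ha ha'
  refine ⟨?_, ?_, ?_, ?_⟩
  · simp only [Matrix.mul_apply, Fin.sum_univ_two, ha, hb, ha', hc']
    exact ⟨4 * a * a' + a + a' + b * c', by ring⟩
  · simp only [Matrix.mul_apply, Fin.sum_univ_two, hb, hb']
    exact ⟨A 0 0 * b' + b * B 1 1, by ring⟩
  · simp only [Matrix.mul_apply, Fin.sum_univ_two, hc, hc']
    exact ⟨c * B 0 0 + A 1 1 * c', by ring⟩
  · rw [Matrix.det_mul]
    rcases hd with h | h <;> rcases hd' with h' | h' <;> simp [h, h']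

theorem isLevelTwo_reflMatrix (i : Fin 3) : IsLevelTwo (reflMatrix i) := by
  fin_cases i <;> simp [IsLevelTwo, reflMatrix, Matrix.det_fin_two]

theorem isLevelTwo_mat (g : W3) : IsLevelTwo (mat g) := by
  have hg : g ∈ Subgroup.closure (Set.range (PresentedGroup.of : Fin 3 → W3)) := by
    rw [PresentedGroup.closure_range_of]; trivial
  induction hg using Subgroup.closure_induction_left with
  | one => simp [mat_one, IsLevelTwo]
  | mul_left x hx y _ hy =>
    obtain ⟨i, rfl⟩ := hx
    rw [mat_mul, mat_of]
    exact (isLevelTwo_reflMatrix i).mul hy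
  | inv_mul_cancel x hx y _ hy =>
    obtain ⟨i, rfl⟩ := hx
    rw [inv_eq_of_mul_eq_one_left (of_mul_self i), mat_mul, mat_of]
    exact (isLevelTwo_reflMatrix i).mul hy

theorem mem_range_of_mat_mul_mem_range {g : W3} {A : Matrix (Fin 2) (Fin 2) ℤ}
    (h : mat g * A ∈ Set.range mat) : A ∈ Set.range mat := by
  obtain ⟨k, hk⟩ := h
  refine ⟨g⁻¹ * k, ?_⟩
  rw [mat_mul, hk, ← mul_assoc, ← mat_mul, inv_mul_cancel, mat_one, one_mul]

theorem unipotent_mem_range (k : ℤ) : !![1, 2 * k; 0, 1] ∈ Set.range mat := by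
  have step (k : ℤ) : mat (t * s) * !![1, 2 * k; 0, 1] = !![1, 2 * (k + 1); 0, 1] := by
    rw [mat_mul, mat_t, mat_s]
    ext i j
    fin_cases i <;> fin_cases j <;> simp [Matrix.mul_apply, Fin.sum_univ_two]; ring
  induction k using Int.induction_on with
  | zero => exact ⟨1, by rw [mat_one]; decide⟩
  | succ k ih =>
    obtain ⟨g, hg⟩ := ih
    exact ⟨t * s * g, by rw [mat_mul, hg, step]⟩
  | pred k ih =>
    refine mem_range_of_mat_mul_mem_range (g := t * s) ?_
    rw [step]
    simpa using ih

/-- Sanov's theorem: every matrix satisfying the congruences comes from `W₃`. -/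
theorem IsLevelTwo.mem_range {A : Matrix (Fin 2) (Fin 2) ℤ} (hA : IsLevelTwo A) :
    A ∈ Set.range mat := by
  induction hn : (A 0 0).natAbs + (A 1 0).natAbs using Nat.strong_induction_on generalizing A with
  | _ n ih =>
  subst hn
  have descend (g : W3)
      (hg : ((mat g * A) 0 0).natAbs + ((mat g * A) 1 0).natAbs
        < (A 0 0).natAbs + (A 1 0).natAbs) : A ∈ Set.range mat :=
    mem_range_of_mat_mul_mem_range (ih _ hg ((isLevelTwo_mat g).mul hA) rfl)
  have hr := descend r
  have ht := descend t
  have hrs := descend (r * s)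
  have hts := descend (t * s)
  simp [mat_mul, mat_r, mat_s, mat_t, Matrix.mul_apply, Fin.sum_univ_two] at hr ht hrs hts
  obtain ⟨ha, ⟨b, hb⟩, hc, hd⟩ := hA
  by_cases hc0 : A 1 0 = 0
  · have hu : A 0 0 = 1 := by
      rw [Matrix.det_fin_two, hc0, mul_zero, sub_zero] at hd
      have : IsUnit (A 0 0) := by
        rcases hd with h | h
        · exact IsUnit.of_mul_eq_one _ h
        · exact IsUnit.of_mul_eq_one (-A 1 1) (by rw [mul_neg, h, neg_neg])
      rcases Int.isUnit_iff.1 this with h | h <;> omega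
    rw [Matrix.det_fin_two, hc0, hu] at hd
    simp only [one_mul, mul_zero, sub_zero] at hd
    rcases hd with h | h
    · convert unipotent_mem_range b
      ext i j
      fin_cases i <;> fin_cases j <;> simp [*]
    · refine mem_range_of_mat_mul_mem_range (g := s) ?_
      convert unipotent_mem_range b
      rw [mat_s]
      ext i j
      fin_cases i <;> fin_cases j <;> simp [Matrix.mul_apply, Fin.sum_univ_two, *]
  · by_contra hcon
    have hr := mt hr hcon
    have ht := mt ht hcon
    have hrs := mt hrs hcon
    have hts := mt hts hcon
    omega

/-! ### Generation of the even subgroup -/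

instance : E.Normal := inferInstanceAs parity.ker.Normal

theorem parity_of (i : Fin 3) : parity (PresentedGroup.of i) = Multiplicative.ofAdd 1 :=
  PresentedGroup.toGroup.of _

theorem s_notMem_E : s ∉ E := by
  intro h
  have h : parity s = 1 := h
  rw [s, parity_of] at h
  exact absurd h (by decide)

theorem r_mul_s_mem : r * s ∈ E := by
  change parity (r * s) = 1
  rw [r, s, map_mul, parity_of, parity_of]
  decide

theorem t_mul_s_mem : t * s ∈ E := by
  change parity (t * s) = 1
  rw [t, s, map_mul, parity_of, parity_of]
  decide

theorem mul_mem_E {g h : W3} (hg : g ∉ E) (hh : h ∉ E) : g * h ∈ E := by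
  have key : ∀ x y : Multiplicative (ZMod 2), x ≠ 1 → y ≠ 1 → x * y = 1 := by decide
  change parity (g * h) = 1
  rw [map_mul]
  exact key _ _ hg hh

/-- The generator `rs` of `E`. -/
def a : E := ⟨r * s, r_mul_s_mem⟩

/-- The generator `ts` of `E`. -/
def b : E := ⟨t * s, t_mul_s_mem⟩

/-- Conjugation by `s`, as an automorphism of `E`. -/
def conjS : MulAut E := MulAut.conjNormal s

theorem conjS_a : conjS a = a⁻¹ := by
  ext
  simp [conjS, a, mul_assoc, inv_eq_of_mul_eq_one_left r_mul_r,
    inv_eq_of_mul_eq_one_left s_mul_s, s_mul_s]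

theorem conjS_b : conjS b = b⁻¹ := by
  ext
  simp [conjS, b, mul_assoc, inv_eq_of_mul_eq_one_left t_mul_t,
    inv_eq_of_mul_eq_one_left s_mul_s, s_mul_s]

theorem closure_a_b : Subgroup.closure {a, b} = ⊤ := by
  set K := Subgroup.closure {a, b}
  have ha : a ∈ K := Subgroup.subset_closure (by simp)
  have hb : b ∈ K := Subgroup.subset_closure (by simp)
  have hconj : ∀ h ∈ K, conjS h ∈ K := by
    intro h hh
    have : K ≤ K.comap conjS.toMonoidHom := by
      refine (Subgroup.closure_le _).2 ?_
      rintro _ (rfl | rfl)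
      · simpa [conjS_a] using ha
      · simpa [conjS_b] using hb
    exact this hh
  -- the set `K ∪ K s` is stable under left multiplication by the generators
  have key (g : W3) : ∃ k ∈ K, g = (k : W3) ∨ g = (k : W3) * s := by
    have hg : g ∈ Subgroup.closure (Set.range (PresentedGroup.of : Fin 3 → W3)) := by
      rw [PresentedGroup.closure_range_of]; trivial
    have hs (k : E) : s * (k : W3) = (conjS k : W3) * s := by simp [conjS]
    have step (i : Fin 3) (y : W3) (hy : ∃ k ∈ K, y = (k : W3) ∨ y = (k : W3) * s) :
        ∃ k ∈ K, PresentedGroup.of i * y = (k : W3) ∨ PresentedGroup.of i * y = (k : W3) * s := by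
      obtain ⟨c, hc, hi⟩ : ∃ c ∈ K, PresentedGroup.of i = (c : W3) * s := by
        fin_cases i
        · exact ⟨a, ha, by simp [a, mul_assoc, s_mul_s, r]⟩
        · exact ⟨1, one_mem _, by simp [s]⟩
        · exact ⟨b, hb, by simp [b, mul_assoc, s_mul_s, t]⟩
      obtain ⟨k, hk, rfl | rfl⟩ := hy
      · exact ⟨c * conjS k, mul_mem hc (hconj k hk), Or.inr (by
          rw [hi, mul_assoc, hs, Subgroup.coe_mul, mul_assoc])⟩
      · exact ⟨c * conjS k, mul_mem hc (hconj k hk), Or.inl (by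
          rw [hi, mul_assoc, ← mul_assoc s, hs, mul_assoc, s_mul_s, mul_one, Subgroup.coe_mul])⟩
    induction hg using Subgroup.closure_induction_left with
    | one => exact ⟨1, one_mem _, Or.inl rfl⟩
    | mul_left x hx y _ hy =>
      obtain ⟨i, rfl⟩ := hx
      exact step i y hy
    | inv_mul_cancel x hx y _ hy =>
      obtain ⟨i, rfl⟩ := hx
      rw [inv_eq_of_mul_eq_one_left (of_mul_self i)]
      exact step i y hy
  refine eq_top_iff.2 fun h _ => ?_
  obtain ⟨k, hk, hh | hh⟩ := key h
  · rwa [Subtype.ext hh]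
  · refine absurd ?_ s_notMem_E
    rw [eq_inv_mul_iff_mul_eq.2 hh.symm]
    exact mul_mem (inv_mem k.2) h.2

/-- Two homomorphisms out of `E` that agree on `rs` and `ts` are equal. -/
theorem hom_ext {G : Type*} [Group G] {f g : E →* G} (ha : f a = g a) (hb : f b = g b) : f = g :=
  MonoidHom.eq_of_eqOn_dense closure_a_b (by rintro _ (rfl | rfl) <;> assumption)

end W3

namespace W3

/-! ### Inverting a pair of generators -/

theorem det_mat (h : E) : (mat h).det = 1 := by
  have key : ((Units.map Matrix.detMonoidHom).comp rep).comp E.subtype = 1 := by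
    refine hom_ext (Units.ext ?_) (Units.ext ?_)
    · change (mat (r * s)).det = 1
      rw [mat_mul, mat_r, mat_s]
      decide
    · change (mat (t * s)).det = 1
      rw [mat_mul, mat_t, mat_s]
      decide
  exact congrArg Units.val (DFunLike.congr_fun key h)

theorem mat_inv (h : E) : mat (h⁻¹ : E) = (mat h).adjugate := by
  calc mat (h⁻¹ : E) = mat (h⁻¹ : E) * (mat h * (mat h).adjugate) := by
        rw [Matrix.mul_adjugate, det_mat, one_smul, mul_one]
    _ = (mat h).adjugate := by
        rw [← mul_assoc, ← mat_mul, ← Subgroup.coe_mul, inv_mul_cancel, Subgroup.coe_one, mat_one,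
          one_mul]

theorem mat_a : mat a = !![1, 0; 2, 1] := by
  change mat (r * s) = _
  rw [mat_mul, mat_r, mat_s]
  decide

theorem mat_b : mat b = !![1, 2; 0, 1] := by
  change mat (t * s) = _
  rw [mat_mul, mat_t, mat_s]
  decide

/-- Modulo `4`, the upper right entry is a homomorphism on `E`. -/
def upperEntry : E →* Multiplicative (ZMod 4) :=
  MonoidHom.mk' (fun h => Multiplicative.ofAdd ((mat h 0 1 : ℤ) : ZMod 4)) fun g h => by
    rw [← ofAdd_add, ← Int.cast_add]
    refine congrArg _ ((ZMod.intCast_eq_intCast_iff_dvd_sub _ _ 4).2 ?_)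
    obtain ⟨⟨x, hx⟩, ⟨y, hy⟩, -⟩ := isLevelTwo_mat g
    obtain ⟨⟨x', hx'⟩, ⟨y', hy'⟩, ⟨z', hz'⟩, -⟩ := isLevelTwo_mat h
    have hd := det_mat h
    rw [sub_eq_iff_eq_add] at hx hx'
    rw [Matrix.det_fin_two, hx', hy', hz'] at hd
    obtain ⟨k, hk⟩ : ∃ k, mat h 1 1 = 1 + 4 * k := ⟨y' * z' - x' * mat h 1 1, by linarith⟩
    rw [Subgroup.coe_mul, mat_mul, Matrix.mul_apply, Fin.sum_univ_two, hx, hy, hk, hy']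
    exact ⟨-(2 * x * y' + 2 * y * k), by push_cast; ring⟩

/-- A matrix that intertwines two representations of `E` on `rs` and `ts` does so everywhere. -/
theorem semiconjBy_of_generators {f g : E →* (Matrix (Fin 2) (Fin 2) ℤ)ˣ}
    {M : Matrix (Fin 2) (Fin 2) ℤ} (ha : SemiconjBy M (f a) (g a)) (hb : SemiconjBy M (f b) (g b))
    (h : E) : SemiconjBy M (f h) (g h) := by
  have hh : h ∈ Subgroup.closure {a, b} := by rw [closure_a_b]; trivial
  induction hh using Subgroup.closure_induction with
  | mem x hx =>
    obtain rfl | rfl := hx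
    exacts [ha, hb]
  | one => simp
  | mul x y _ _ hx hy => simpa using hx.mul_right hy
  | inv x _ hx => simpa using hx.units_inv_right

theorem commutator_mul_eq (X Y : Matrix (Fin 2) (Fin 2) ℤ) :
    (X * Y - Y * X) * X = X.adjugate * (X * Y - Y * X) ∧
      (X * Y - Y * X) * Y = Y.adjugate * (X * Y - Y * X) := by
  constructor <;>
  · rw [Matrix.adjugate_fin_two]
    ext i j
    fin_cases i <;> fin_cases j <;>
      simp [Matrix.mul_apply, Fin.sum_univ_two] <;> ring

theorem isUnit_of_dvd_sq {p q r D : ℤ} (h : ∀ n : ℤ, n ∣ p → n ∣ q → n ∣ r → IsUnit n)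
    (hp : D ∣ p ^ 2) (hq : D ∣ q ^ 2) (hr : D ∣ r ^ 2) : D = 1 ∨ D = -1 := by
  by_contra hD
  obtain ⟨l, hl, hlD⟩ := Nat.exists_prime_and_dvd (n := D.natAbs) (by omega)
  have hl' : Prime (l : ℤ) := Nat.prime_iff_prime_int.1 hl
  have hlD : (l : ℤ) ∣ D := Int.natCast_dvd.2 hlD
  exact hl'.not_isUnit (h l (hl'.dvd_of_dvd_pow (hlD.trans hp)) (hl'.dvd_of_dvd_pow (hlD.trans hq))
    (hl'.dvd_of_dvd_pow (hlD.trans hr)))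

theorem level_two_of_normalizes {p q r : ℤ} {V W : Matrix (Fin 2) (Fin 2) ℤ}
    (h : ∀ n : ℤ, n ∣ p → n ∣ q → n ∣ r → IsUnit n)
    (hV : !![p, q; r, -p] * !![1, 2; 0, 1] = V * !![p, q; r, -p])
    (hW : !![p, q; r, -p] * !![1, 0; 2, 1] = W * !![p, q; r, -p])
    (hV2 : IsLevelTwo V) (hW2 : IsLevelTwo W) (hV4 : 4 ∣ V 0 1 - 2) :
    -p ^ 2 - q * r = -1 ∧ ¬ 2 ∣ p ∧ 2 ∣ q ∧ 2 ∣ r := by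
  obtain ⟨⟨x, hx⟩, -, ⟨z, hz⟩, -⟩ := hV2
  obtain ⟨⟨u, hu⟩, ⟨w, hw⟩, -⟩ := hW2
  obtain ⟨y, hy⟩ := hV4
  rw [sub_eq_iff_eq_add] at hx hu hy
  have v00 := congrFun₂ hV 0 0
  have v01 := congrFun₂ hV 0 1
  have v10 := congrFun₂ hV 1 0
  have v11 := congrFun₂ hV 1 1
  have w00 := congrFun₂ hW 0 0
  have w01 := congrFun₂ hW 0 1
  simp [Matrix.mul_apply, Fin.sum_univ_two] at v00 v01 v10 v11 w00 w01
  rw [hx, hy] at v00 v01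
  rw [hz] at v10 v11
  rw [hu, hw] at w00 w01
  have hp : p ^ 2 = (-p ^ 2 - q * r) * (2 * y + 1) := by
    refine mul_left_cancel₀ two_ne_zero ?_
    linear_combination p * v01 - q * v00
  have hr : r ^ 2 = (-p ^ 2 - q * r) * (-z) := by
    refine mul_left_cancel₀ two_ne_zero ?_
    linear_combination p * v10 + r * v11
  have hq : q ^ 2 = (-p ^ 2 - q * r) * (-w) := by
    refine mul_left_cancel₀ two_ne_zero ?_
    linear_combination q * w00 - p * w01
  have hpr : p * r = 2 * ((-p ^ 2 - q * r) * (-x)) := by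
    refine mul_left_cancel₀ two_ne_zero ?_
    linear_combination p * v00 + r * v01
  have hpq : p * q = 2 * ((-p ^ 2 - q * r) * (-u)) := by
    refine mul_left_cancel₀ two_ne_zero ?_
    linear_combination p * w00 + r * w01
  have hD := isUnit_of_dvd_sq h ⟨_, hp⟩ ⟨_, hq⟩ ⟨_, hr⟩
  have hodd : ¬ 2 ∣ p := by
    rintro ⟨k, rfl⟩
    have : (2 * k) ^ 2 = 2 * (2 * k ^ 2) := by ring
    rcases hD with hD | hD <;> rw [hD] at hp <;> omega
  have hq2 : 2 ∣ q := (Int.prime_two.dvd_or_dvd ⟨_, hpq⟩).resolve_left hodd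
  have hr2 : 2 ∣ r := (Int.prime_two.dvd_or_dvd ⟨_, hpr⟩).resolve_left hodd
  refine ⟨hD.resolve_left fun hD => ?_, hodd, hq2, hr2⟩
  obtain ⟨j, rfl⟩ := hq2
  obtain ⟨l, rfl⟩ := hr2
  obtain ⟨k, rfl⟩ : ∃ k, p = 2 * k + 1 := ⟨p / 2, by omega⟩
  have : -(2 * k + 1) ^ 2 - 2 * j * (2 * l) = -4 * (k ^ 2 + k + j * l) - 1 := by ring
  omega

/-- Every automorphism of `E` carries conjugation by `s` to conjugation by an odd involution. -/
theorem exists_involution_conj (ψ : MulAut E) :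
    ∃ w : W3, w ∉ E ∧ w * w = 1 ∧ ∀ h : E, w * (ψ h : W3) = (ψ (conjS h) : W3) * w := by
  set X := mat (ψ a)
  set Y := mat (ψ b)
  have hM (h : E) : (X * Y - Y * X) * mat (ψ h) = mat (ψ (conjS h)) * (X * Y - Y * X) := by
    refine semiconjBy_of_generators (f := (rep.comp E.subtype).comp ψ.toMonoidHom)
      (g := (rep.comp E.subtype).comp (ψ.toMonoidHom.comp conjS.toMonoidHom)) ?_ ?_ h
    · change _ * X = mat (ψ (conjS a)) * _
      rw [conjS_a, map_inv, mat_inv]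
      exact (commutator_mul_eq X Y).1
    · change _ * Y = mat (ψ (conjS b)) * _
      rw [conjS_b, map_inv, mat_inv]
      exact (commutator_mul_eq X Y).2
  have hM0 : X * Y - Y * X ≠ 0 := by
    intro h0
    have hab : mat (ψ (a * b)) = mat (ψ (b * a)) := by
      simpa [mat_mul] using sub_eq_zero.1 h0
    have hab : a * b = b * a := ψ.injective (Subtype.ext (mat_injective hab))
    have hab := congrArg (fun h : E => mat h) hab
    simp only [Subgroup.coe_mul, mat_mul, mat_a, mat_b] at hab
    exact absurd hab (by decide)
  set M := X * Y - Y * X with hMdef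
  have htr : M 1 1 = -M 0 0 := by
    simp only [hMdef, Matrix.sub_apply, Matrix.mul_apply, Fin.sum_univ_two]
    ring
  clear_value M
  obtain ⟨e, he, hgcd⟩ := Finset.extract_gcd ![M 0 0, M 0 1, M 1 0] Finset.univ_nonempty
  set G := Finset.univ.gcd ![M 0 0, M 0 1, M 1 0]
  have h0 : M 0 0 = G * e 0 := he 0 (Finset.mem_univ _)
  have h1 : M 0 1 = G * e 1 := he 1 (Finset.mem_univ _)
  have h2 : M 1 0 = G * e 2 := he 2 (Finset.mem_univ _)
  have hMG : M = G • !![e 0, e 1; e 2, -e 0] := by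
    ext i j
    fin_cases i <;> fin_cases j <;> simp [h0, h1, h2, htr]
  have hG : G ≠ 0 := by
    intro h
    rw [h, zero_smul] at hMG
    exact hM0 hMG
  have hN (h : E) : !![e 0, e 1; e 2, -e 0] * mat h
      = mat (ψ (conjS (ψ.symm h))) * !![e 0, e 1; e 2, -e 0] := by
    have := hM (ψ.symm h)
    rw [hMG, MulEquiv.apply_symm_apply, Matrix.smul_mul, Matrix.mul_smul] at this
    exact smul_right_injective _ hG this
  have hentry : 4 ∣ mat (ψ (conjS (ψ.symm b))) 0 1 - 2 := by
    have inv2 : ∀ x : E, upperEntry x⁻¹ = upperEntry x := by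
      intro x
      refine congrArg Multiplicative.ofAdd ((ZMod.intCast_eq_intCast_iff_dvd_sub _ _ 4).2 ?_)
      obtain ⟨-, ⟨k, hk⟩, -⟩ := isLevelTwo_mat x
      rw [mat_inv, Matrix.adjugate_fin_two, hk]
      exact ⟨k, by simp; ring⟩
    have key : upperEntry.comp (ψ.toMonoidHom.comp conjS.toMonoidHom)
        = upperEntry.comp ψ.toMonoidHom := by
      refine hom_ext ?_ ?_
      · change upperEntry (ψ (conjS a)) = upperEntry (ψ a)
        rw [conjS_a, map_inv, inv2]
      · change upperEntry (ψ (conjS b)) = upperEntry (ψ b)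
        rw [conjS_b, map_inv, inv2]
    have hb : upperEntry (ψ (conjS (ψ.symm b))) = upperEntry (ψ (ψ.symm b)) :=
      DFunLike.congr_fun key _
    rw [MulEquiv.apply_symm_apply] at hb
    have hb : ((mat b 0 1 : ℤ) : ZMod 4) = (mat (ψ (conjS (ψ.symm b))) 0 1 : ℤ) :=
      (Multiplicative.ofAdd.injective hb).symm
    rw [mat_b] at hb
    exact (ZMod.intCast_eq_intCast_iff_dvd_sub _ _ 4).1 hb
  obtain ⟨hdet, hodd, h1, h2⟩ := level_two_of_normalizes
    (fun n hp hq hr => isUnit_of_dvd_one (hgcd ▸ Finset.dvd_gcd fun i _ => by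
      fin_cases i <;> assumption))
    (mat_b ▸ hN b) (mat_a ▸ hN a) (isLevelTwo_mat _) (isLevelTwo_mat _) hentry
  -- up to sign, the primitive multiple of the commutator lies in the image of `W₃`
  obtain ⟨ε, hε, hε4⟩ : ∃ ε : ℤ, ε * ε = 1 ∧ 4 ∣ ε * e 0 - 1 := by
    rcases (by omega : 4 ∣ e 0 - 1 ∨ 4 ∣ -e 0 - 1) with h | h
    · exact ⟨1, by simpa using h⟩
    · exact ⟨-1, by simpa using h⟩
  have hdetN : (ε • !![e 0, e 1; e 2, -e 0]).det = -1 := by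
    rw [Matrix.det_smul, Matrix.det_fin_two_of, Fintype.card_fin, pow_two, hε]
    linarith
  obtain ⟨w, hw⟩ : ε • !![e 0, e 1; e 2, -e 0] ∈ Set.range mat :=
    IsLevelTwo.mem_range ⟨by simpa using hε4, by simpa using h1.mul_left ε,
      by simpa using h2.mul_left ε, Or.inr hdetN⟩
  refine ⟨w, fun hwE => ?_, mat_injective ?_, fun h => mat_injective ?_⟩
  · have := det_mat ⟨w, hwE⟩
    rw [hw, hdetN] at this
    norm_num at this
  · rw [mat_mul, hw, mat_one, Matrix.smul_mul, Matrix.mul_smul, smul_smul, hε, one_smul]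
    ext i j
    fin_cases i <;> fin_cases j <;> simp [Matrix.mul_apply, Fin.sum_univ_two] <;> linarith
  · have := hN (ψ h)
    rw [MulEquiv.symm_apply_apply] at this
    rw [mat_mul, mat_mul, hw, Matrix.smul_mul, this, Matrix.mul_smul]

end W3

open W3

theorem statement17 :
    ∀ ψ : MulAut E, ∃ φ : MulAut W3, ∀ h : E, φ (h : W3) = (ψ h : W3) := by
  intro ψ
  obtain ⟨w, hwE, hww, hw⟩ := exists_involution_conj ψ
  have hinv (c : E) (hc : conjS c = c⁻¹) : (ψ c : W3) * w * ((ψ c : W3) * w) = 1 := by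
    rw [mul_assoc, ← mul_assoc w, hw, hc, map_inv, mul_assoc _ w w, hww, mul_one,
      ← Subgroup.coe_mul, mul_inv_cancel, Subgroup.coe_one]
  let f : Fin 3 → W3 := ![ψ a * w, w, ψ b * w]
  have hf (i : Fin 3) : f i * f i = 1 := by
    fin_cases i
    exacts [hinv a conjS_a, hww, hinv b conjS_b]
  let φ : W3 →* W3 := W3.lift f hf
  have hr : φ r = ψ a * w := lift_of f hf 0
  have hs : φ s = w := lift_of f hf 1
  have ht : φ t = ψ b * w := lift_of f hf 2
  have hφ (h : E) : φ h = ψ h := by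
    refine DFunLike.congr_fun
      (hom_ext (f := φ.comp E.subtype) (g := E.subtype.comp ψ.toMonoidHom) ?_ ?_) h
    · change φ (r * s) = ψ a
      rw [map_mul, hr, hs, mul_assoc, hww, mul_one]
    · change φ (t * s) = ψ b
      rw [map_mul, ht, hs, mul_assoc, hww, mul_one]
  have hφE (g : W3) (hg : g ∈ E) : φ g ∈ E := by
    rw [hφ ⟨g, hg⟩]
    exact (ψ _).2
  refine ⟨MulEquiv.ofBijective φ ⟨?_, ?_⟩, hφ⟩
  · refine (injective_iff_map_eq_one φ).2 fun g hg => ?_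
    by_cases hgE : g ∈ E
    · have := hφ ⟨g, hgE⟩
      rw [hg] at this
      have : ψ ⟨g, hgE⟩ = 1 := Subtype.ext this.symm
      exact congrArg Subtype.val ((map_eq_one_iff ψ ψ.injective).1 this)
    · have := hφE _ (mul_mem_E hgE s_notMem_E)
      rw [map_mul, hg, one_mul, hs] at this
      exact absurd this hwE
  · have hsurj (h : E) : ∃ g, φ g = h := ⟨ψ.symm h, by rw [hφ, MulEquiv.apply_symm_apply]⟩
    intro g
    by_cases hgE : g ∈ E
    · exact hsurj ⟨g, hgE⟩
    · obtain ⟨k, hk⟩ := hsurj ⟨g * w, mul_mem_E hgE hwE⟩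
      exact ⟨k * s, by rw [map_mul, hk, hs, mul_assoc, hww, mul_one]⟩
end
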